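/- Define F(μ) = Σᵢ μᵢ zᵢ(μ) − ln Z(μ) + (1/2) Σᵢ ln zᵢ(μ) for μ ∈ ℝ³. Then there exists a constant C > 0 such that for all μ, ν ∈ ℝ³, |F(μ) − F(ν)| ≤ C ‖z(μ) − z(ν)‖, where z(μ) = (z₁(μ), z₂(μ), z₃(μ)) and ‖·‖ is the Euclidean norm on ℝ³. (F(μ) equals the correction term ΔS = S − Ŝ of the three-dimensional entropy decomposition evaluated at q = z(μ) − (1/3,1/3,1/3); this is the Lipschitz continuity asserted in Theorem 1.1 for d = 3.) -/

import Mathlib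

open Real Filter

/-- Integral of a function over the unit sphere `S² ⊂ ℝ³` with respect to the
surface measure, written in spherical coordinates
`m = (sin θ cos φ, sin θ sin φ, cos θ)` with surface element `sin θ dφ dθ`. -/
noncomputable def sphereIntegral (f : (Fin 3 → ℝ) → ℝ) : ℝ :=
  ∫ θ in (0:ℝ)..Real.pi, ∫ φ in (0:ℝ)..(2 * Real.pi),
    f ![Real.sin θ * Real.cos φ, Real.sin θ * Real.sin φ, Real.cos θ] * Real.sin θ

/-- The Bingham normalizing constant
`Z(μ) = (1/(4π)) ∫_{S²} exp(μ₁ m₁² + μ₂ m₂² + μ₃ m₃²) dσ(m)`. -/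
noncomputable def binghamZ (μ : Fin 3 → ℝ) : ℝ :=
  (1 / (4 * Real.pi)) * sphereIntegral (fun m => Real.exp (∑ i, μ i * (m i) ^ 2))

/-- The second moments of the Bingham distribution:
`zᵢ(μ) = (1/(4π Z(μ))) ∫_{S²} mᵢ² exp(μ₁ m₁² + μ₂ m₂² + μ₃ m₃²) dσ(m)`. -/
noncomputable def binghamZ2 (μ : Fin 3 → ℝ) (i : Fin 3) : ℝ :=
  (1 / (4 * Real.pi * binghamZ μ)) *
    sphereIntegral (fun m => (m i) ^ 2 * Real.exp (∑ j, μ j * (m j) ^ 2))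

/-- The correction term of the 3D entropy decomposition, expressed in `μ`:
`F(μ) = Σᵢ μᵢ zᵢ(μ) − ln Z(μ) + (1/2) Σᵢ ln zᵢ(μ)`. -/
noncomputable def correction3d (μ : Fin 3 → ℝ) : ℝ :=
  (∑ i, μ i * binghamZ2 μ i) - Real.log (binghamZ μ)
    + (1/2) * ∑ i, Real.log (binghamZ2 μ i)

noncomputable def sph (θ φ : ℝ) : Fin 3 → ℝ :=
  ![Real.sin θ * Real.cos φ, Real.sin θ * Real.sin φ, Real.cos θ]

lemma sph_cont : Continuous (fun p : ℝ × ℝ => sph p.1 p.2) := by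
  unfold sph
  refine continuous_pi fun i => ?_
  fin_cases i <;> simp <;> fun_prop

lemma sph_sum (θ φ : ℝ) : ∑ i, (sph θ φ i) ^ 2 = 1 := by
  simp [sph, Fin.sum_univ_three]
  have h1 := Real.sin_sq_add_cos_sq θ
  have h2 := Real.sin_sq_add_cos_sq φ
  linear_combination h1 + (Real.sin θ)^2 * h2

lemma sI_eq (f : (Fin 3 → ℝ) → ℝ) : sphereIntegral f =
    ∫ θ in (0:ℝ)..Real.pi, ∫ φ in (0:ℝ)..(2 * Real.pi), f (sph θ φ) * Real.sin θ := rfl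

lemma inner_cont {f : (Fin 3 → ℝ) → ℝ} (hf : Continuous f) :
    Continuous (fun p : ℝ × ℝ => f (sph p.1 p.2) * Real.sin p.1) :=
  (hf.comp sph_cont).mul (Real.continuous_sin.comp continuous_fst)

lemma outer_cont {g : ℝ → ℝ → ℝ} (hg : Continuous (fun p : ℝ × ℝ => g p.1 p.2)) :
    Continuous (fun θ => ∫ φ in (0:ℝ)..(2 * Real.pi), g θ φ) :=
  intervalIntegral.continuous_parametric_intervalIntegral_of_continuous' hg _ _

lemma sec_cont {g : ℝ → ℝ → ℝ} (hg : Continuous (fun p : ℝ × ℝ => g p.1 p.2)) (θ : ℝ) :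
    Continuous (g θ) := hg.comp (by fun_prop : Continuous fun y : ℝ => (θ, y))

lemma sI_add {f g : (Fin 3 → ℝ) → ℝ} (hf : Continuous f) (hg : Continuous g) :
    sphereIntegral (fun m => f m + g m) = sphereIntegral f + sphereIntegral g := by
  simp only [sI_eq, add_mul]
  have hf' := inner_cont hf
  have hg' := inner_cont hg
  rw [← intervalIntegral.integral_add]
  · congr 1; ext θ
    rw [intervalIntegral.integral_add]
    · exact (sec_cont (g := fun θ φ => f (sph θ φ) * Real.sin θ) hf' θ).intervalIntegrable _ _
    · exact (sec_cont (g := fun θ φ => g (sph θ φ) * Real.sin θ) hg' θ).intervalIntegrable _ _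
  · exact (outer_cont (g := fun θ φ => f (sph θ φ) * Real.sin θ) hf').intervalIntegrable _ _
  · exact (outer_cont (g := fun θ φ => g (sph θ φ) * Real.sin θ) hg').intervalIntegrable _ _

lemma sI_mul (c : ℝ) (f : (Fin 3 → ℝ) → ℝ) :
    sphereIntegral (fun m => c * f m) = c * sphereIntegral f := by
  simp only [sI_eq, mul_assoc, intervalIntegral.integral_const_mul]

lemma sI_congr {f g : (Fin 3 → ℝ) → ℝ} (h : ∀ m, ∑ i, m i ^ 2 = 1 → f m = g m) :
    sphereIntegral f = sphereIntegral g := by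
  simp only [sI_eq]
  simp only [fun θ φ => h _ (sph_sum θ φ)]

lemma sI_mono {f g : (Fin 3 → ℝ) → ℝ} (hf : Continuous f) (hg : Continuous g)
    (h : ∀ m, ∑ i, m i ^ 2 = 1 → f m ≤ g m) :
    sphereIntegral f ≤ sphereIntegral g := by
  simp only [sI_eq]
  have hf' := inner_cont hf
  have hg' := inner_cont hg
  apply intervalIntegral.integral_mono_on Real.pi_pos.le
  · exact (outer_cont (g := fun θ φ => f (sph θ φ) * Real.sin θ) hf').intervalIntegrable _ _
  · exact (outer_cont (g := fun θ φ => g (sph θ φ) * Real.sin θ) hg').intervalIntegrable _ _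
  intro θ hθ
  apply intervalIntegral.integral_mono_on (by positivity)
  · exact (sec_cont (g := fun θ φ => f (sph θ φ) * Real.sin θ) hf' θ).intervalIntegrable _ _
  · exact (sec_cont (g := fun θ φ => g (sph θ φ) * Real.sin θ) hg' θ).intervalIntegrable _ _
  intro φ _
  exact mul_le_mul_of_nonneg_right (h _ (sph_sum θ φ)) (Real.sin_nonneg_of_mem_Icc hθ)

/-- Positivity: a continuous nonnegative function, positive off the coordinate planes. -/
lemma sI_pos {f : (Fin 3 → ℝ) → ℝ} (hf : Continuous f) (h0 : ∀ m, 0 ≤ f m)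
    (h : ∀ m, (∀ i, m i ≠ 0) → 0 < f m) : 0 < sphereIntegral f := by
  simp only [sI_eq]
  have hf' := inner_cont hf
  have hpi := Real.pi_pos
  have hs := fun θ => (sec_cont (g := fun θ φ => f (sph θ φ) * Real.sin θ) hf' θ)
  apply intervalIntegral.integral_pos Real.pi_pos
  · exact (outer_cont (g := fun θ φ => f (sph θ φ) * Real.sin θ) hf').continuousOn
  · intro θ hθ
    apply intervalIntegral.integral_nonneg (by positivity)
    intro φ _
    exact mul_nonneg (h0 _) (Real.sin_nonneg_of_mem_Icc ⟨hθ.1.le, hθ.2⟩)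
  refine ⟨Real.pi / 4, ⟨by positivity, by linarith⟩, ?_⟩
  apply intervalIntegral.integral_pos (by positivity)
  · exact (hs _).continuousOn
  · intro φ _
    exact mul_nonneg (h0 _) (by simp; positivity)
  refine ⟨Real.pi / 4, ⟨by positivity, by linarith⟩, ?_⟩
  refine mul_pos (h _ ?_) (by simp)
  intro i
  fin_cases i <;> simp [sph]

lemma swap_zero {A P : ℝ → ℝ → ℝ} (hA : Continuous (fun p : ℝ × ℝ => A p.1 p.2))
    (hP : ∀ θ φ, HasDerivAt (fun t => P t φ) (A θ φ) θ) (hb : ∀ φ, P Real.pi φ = P 0 φ) :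
    ∫ θ in (0:ℝ)..Real.pi, ∫ φ in (0:ℝ)..(2 * Real.pi), A θ φ = 0 := by
  rw [MeasureTheory.intervalIntegral_intervalIntegral_swap]
  · have : ∀ φ, ∫ θ in (0:ℝ)..Real.pi, A θ φ = 0 := by
      intro φ
      rw [intervalIntegral.integral_eq_sub_of_hasDerivAt (fun x _ => hP x φ)
        ((hA.comp (by fun_prop : Continuous fun y : ℝ => (y, φ))).intervalIntegrable _ _),
        hb, sub_self]
    simp [this]
  · have h1 : MeasureTheory.IntegrableOn (Function.uncurry A)
        (Set.uIcc 0 Real.pi ×ˢ Set.uIcc 0 (2 * Real.pi)) :=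
      (ContinuousOn.integrableOn_compact (isCompact_uIcc.prod isCompact_uIcc)
        (by exact hA.continuousOn))
    exact h1.mono_set (Set.prod_mono Set.uIoc_subset_uIcc Set.uIoc_subset_uIcc)

lemma noswap_zero {A P : ℝ → ℝ → ℝ} (hA : Continuous (fun p : ℝ × ℝ => A p.1 p.2))
    (hP : ∀ θ φ, HasDerivAt (fun t => P θ t) (A θ φ) φ) (hb : ∀ θ, P θ (2 * Real.pi) = P θ 0) :
    ∫ θ in (0:ℝ)..Real.pi, ∫ φ in (0:ℝ)..(2 * Real.pi), A θ φ = 0 := by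
  have : ∀ θ, ∫ φ in (0:ℝ)..(2 * Real.pi), A θ φ = 0 := by
    intro θ
    rw [intervalIntegral.integral_eq_sub_of_hasDerivAt (fun x _ => hP θ x)
      ((sec_cont hA θ).intervalIntegrable _ _), hb, sub_self]
  simp [this]

lemma hasDerivAt_sph_theta (θ φ : ℝ) : HasDerivAt (fun t => sph t φ)
    ![Real.cos θ * Real.cos φ, Real.cos θ * Real.sin φ, -Real.sin θ] θ := by
  rw [hasDerivAt_pi]
  intro i
  fin_cases i
  · simpa [sph] using (Real.hasDerivAt_sin θ).mul_const (Real.cos φ)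
  · simpa [sph] using (Real.hasDerivAt_sin θ).mul_const (Real.sin φ)
  · simpa [sph] using Real.hasDerivAt_cos θ

lemma hasDerivAt_sph_phi (θ φ : ℝ) : HasDerivAt (fun t => sph θ t)
    ![-(Real.sin θ * Real.sin φ), Real.sin θ * Real.cos φ, 0] φ := by
  rw [hasDerivAt_pi]
  intro i
  fin_cases i
  · simpa [sph] using (Real.hasDerivAt_cos φ).const_mul (Real.sin θ)
  · simpa [sph] using (Real.hasDerivAt_sin φ).const_mul (Real.sin θ)
  · simpa [sph] using hasDerivAt_const φ (Real.cos θ)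

lemma fderiv_vec (L : (Fin 3 → ℝ) →L[ℝ] ℝ) (v : Fin 3 → ℝ) :
    L v = v 0 * L (Pi.single 0 1) + v 1 * L (Pi.single 1 1) + v 2 * L (Pi.single 2 1) := by
  have : v = v 0 • (Pi.single 0 1 : Fin 3 → ℝ) + v 1 • (Pi.single 1 1 : Fin 3 → ℝ)
      + v 2 • (Pi.single 2 1 : Fin 3 → ℝ) := by
    ext i; fin_cases i <;> simp
  conv_lhs => rw [this]
  simp [map_add, map_smul]

@[fun_prop]
lemma sph_cont_ab {X : Type*} [TopologicalSpace X] {a b : X → ℝ} (ha : Continuous a)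
    (hb : Continuous b) : Continuous (fun x => sph (a x) (b x)) := by
  have h := Continuous.comp (g := fun p : ℝ × ℝ => sph p.1 p.2) sph_cont (ha.prodMk hb)
  exact h

lemma sph0 (θ φ : ℝ) : sph θ φ 0 = Real.sin θ * Real.cos φ := rfl
lemma sph1 (θ φ : ℝ) : sph θ φ 1 = Real.sin θ * Real.sin φ := rfl
lemma sph2 (θ φ : ℝ) : sph θ φ 2 = Real.cos θ := rfl

lemma g_theta {f : (Fin 3 → ℝ) → ℝ} (hf : ContDiff ℝ 1 f) (θ φ : ℝ) : HasDerivAt (fun t => f (sph t φ))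
    (Real.cos θ * Real.cos φ * fderiv ℝ f (sph θ φ) (Pi.single 0 1)
      + Real.cos θ * Real.sin φ * fderiv ℝ f (sph θ φ) (Pi.single 1 1)
      + (-Real.sin θ) * fderiv ℝ f (sph θ φ) (Pi.single 2 1)) θ := by
  have h : HasDerivAt (fun t => f (sph t φ)) _ θ :=
    ((hf.differentiable (by norm_num)) (sph θ φ)).hasFDerivAt.comp_hasDerivAt θ
    (hasDerivAt_sph_theta θ φ)
  rw [fderiv_vec] at h
  convert h using 1
  simp

lemma g_phi {f : (Fin 3 → ℝ) → ℝ} (hf : ContDiff ℝ 1 f) (θ φ : ℝ) : HasDerivAt (fun t => f (sph θ t))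
    (-(Real.sin θ * Real.sin φ) * fderiv ℝ f (sph θ φ) (Pi.single 0 1)
      + Real.sin θ * Real.cos φ * fderiv ℝ f (sph θ φ) (Pi.single 1 1)) φ := by
  have h : HasDerivAt (fun t => f (sph θ t)) _ φ :=
    ((hf.differentiable (by norm_num)) (sph θ φ)).hasFDerivAt.comp_hasDerivAt φ
    (hasDerivAt_sph_phi θ φ)
  rw [fderiv_vec] at h
  convert h using 1
  simp

lemma sph_two_pi (θ : ℝ) : sph θ (2 * Real.pi) = sph θ 0 := by simp [sph]

lemma two_int {A B : ℝ → ℝ → ℝ} (hA : Continuous (fun p : ℝ × ℝ => A p.1 p.2))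
    (hB : Continuous (fun p : ℝ × ℝ => B p.1 p.2))
    (h1 : ∫ θ in (0:ℝ)..Real.pi, ∫ φ in (0:ℝ)..(2 * Real.pi), A θ φ = 0)
    (h2 : ∫ θ in (0:ℝ)..Real.pi, ∫ φ in (0:ℝ)..(2 * Real.pi), B θ φ = 0) :
    ∫ θ in (0:ℝ)..Real.pi, ∫ φ in (0:ℝ)..(2 * Real.pi), (A θ φ + B θ φ) = 0 := by
  have : ∀ θ, ∫ φ in (0:ℝ)..(2 * Real.pi), (A θ φ + B θ φ) =
      (∫ φ in (0:ℝ)..(2 * Real.pi), A θ φ) + ∫ φ in (0:ℝ)..(2 * Real.pi), B θ φ := by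
    intro θ
    exact intervalIntegral.integral_add ((sec_cont hA θ).intervalIntegrable _ _)
      ((sec_cont hB θ).intervalIntegrable _ _)
  simp only [this]
  rw [intervalIntegral.integral_add ((outer_cont hA).intervalIntegrable _ _)
    ((outer_cont hB).intervalIntegrable _ _), h1, h2, add_zero]

lemma rot01 {f : (Fin 3 → ℝ) → ℝ} (hf : ContDiff ℝ 1 f) : sphereIntegral (fun m => m 1 * fderiv ℝ f m (Pi.single 0 1)
    - m 0 * fderiv ℝ f m (Pi.single 1 1)) = 0 := by
  have cf := hf.continuous
  have cd : Continuous (fderiv ℝ f) := hf.continuous_fderiv (by norm_num)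
  rw [sI_eq]
  apply noswap_zero (P := fun θ φ => f (sph θ φ) * (-Real.sin θ))
  · fun_prop
  · intro θ φ
    refine ((g_phi hf θ φ).mul_const (-Real.sin θ)).congr_deriv ?_
    simp only [sph0, sph1]; ring
  · intro θ; rw [sph_two_pi]

lemma rot02 {f : (Fin 3 → ℝ) → ℝ} (hf : ContDiff ℝ 1 f) : sphereIntegral (fun m => m 2 * fderiv ℝ f m (Pi.single 0 1)
    - m 0 * fderiv ℝ f m (Pi.single 2 1)) = 0 := by
  have cf := hf.continuous
  have cd : Continuous (fderiv ℝ f) := hf.continuous_fderiv (by norm_num)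
  have h1 := swap_zero (P := fun θ φ => Real.sin θ * (Real.cos φ * f (sph θ φ)))
    (A := fun θ φ => Real.cos θ * (Real.cos φ * f (sph θ φ)) + Real.sin θ * (Real.cos φ *
    (Real.cos θ * Real.cos φ * fderiv ℝ f (sph θ φ) (Pi.single 0 1)
      + Real.cos θ * Real.sin φ * fderiv ℝ f (sph θ φ) (Pi.single 1 1)
      + (-Real.sin θ) * fderiv ℝ f (sph θ φ) (Pi.single 2 1)))) (by fun_prop)
    (fun θ φ => (Real.hasDerivAt_sin θ).mul ((g_theta hf θ φ).const_mul (Real.cos φ)))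
    (by simp)
  have h2 := noswap_zero (P := fun θ φ => (-Real.cos θ) * (Real.sin φ * f (sph θ φ)))
    (A := fun θ φ => (-Real.cos θ) * (Real.cos φ * f (sph θ φ) + Real.sin φ *
    (-(Real.sin θ * Real.sin φ) * fderiv ℝ f (sph θ φ) (Pi.single 0 1)
      + Real.sin θ * Real.cos φ * fderiv ℝ f (sph θ φ) (Pi.single 1 1)))) (by fun_prop)
    (fun θ φ => ((Real.hasDerivAt_sin φ).mul (g_phi hf θ φ)).const_mul (-Real.cos θ))
    (by simp)
  have h := two_int (by fun_prop) (by fun_prop) h1 h2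
  rw [sI_eq, ← h]
  congr 1; ext θ; congr 1; ext φ
  have e1 := Real.sin_sq_add_cos_sq φ
  simp only [sph0, sph1, sph2]
  linear_combination (-Real.cos θ * Real.sin θ * fderiv ℝ f (sph θ φ) (Pi.single 0 1)) * e1

lemma rot12 {f : (Fin 3 → ℝ) → ℝ} (hf : ContDiff ℝ 1 f) : sphereIntegral (fun m => m 2 * fderiv ℝ f m (Pi.single 1 1)
    - m 1 * fderiv ℝ f m (Pi.single 2 1)) = 0 := by
  have cf := hf.continuous
  have cd : Continuous (fderiv ℝ f) := hf.continuous_fderiv (by norm_num)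
  have h1 := swap_zero (P := fun θ φ => Real.sin θ * (Real.sin φ * f (sph θ φ)))
    (A := fun θ φ => Real.cos θ * (Real.sin φ * f (sph θ φ)) + Real.sin θ * (Real.sin φ *
    (Real.cos θ * Real.cos φ * fderiv ℝ f (sph θ φ) (Pi.single 0 1)
      + Real.cos θ * Real.sin φ * fderiv ℝ f (sph θ φ) (Pi.single 1 1)
      + (-Real.sin θ) * fderiv ℝ f (sph θ φ) (Pi.single 2 1)))) (by fun_prop)
    (fun θ φ => (Real.hasDerivAt_sin θ).mul ((g_theta hf θ φ).const_mul (Real.sin φ)))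
    (by simp)
  have h2 := noswap_zero (P := fun θ φ => (Real.cos θ) * (Real.cos φ * f (sph θ φ)))
    (A := fun θ φ => (Real.cos θ) * (-Real.sin φ * f (sph θ φ) + Real.cos φ *
    (-(Real.sin θ * Real.sin φ) * fderiv ℝ f (sph θ φ) (Pi.single 0 1)
      + Real.sin θ * Real.cos φ * fderiv ℝ f (sph θ φ) (Pi.single 1 1)))) (by fun_prop)
    (fun θ φ => ((Real.hasDerivAt_cos φ).mul (g_phi hf θ φ)).const_mul (Real.cos θ))
    (by simp [sph_two_pi])
  have h := two_int (by fun_prop) (by fun_prop) h1 h2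
  rw [sI_eq, ← h]
  congr 1; ext θ; congr 1; ext φ
  have e1 := Real.sin_sq_add_cos_sq φ
  simp only [sph0, sph1, sph2]
  linear_combination (-Real.cos θ * Real.sin θ * fderiv ℝ f (sph θ φ) (Pi.single 1 1)) * e1

lemma rot_all {f : (Fin 3 → ℝ) → ℝ} (hf : ContDiff ℝ 1 f) (i k : Fin 3) : sphereIntegral (fun m => m k * fderiv ℝ f m (Pi.single i 1)
    - m i * fderiv ℝ f m (Pi.single k 1)) = 0 := by
  have neg : ∀ g : (Fin 3 → ℝ) → ℝ, sphereIntegral g = 0 → sphereIntegral (fun m => -1 * g m) = 0 := by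
    intro g hg; rw [sI_mul, hg, mul_zero]
  have h01 := rot01 hf
  have h02 := rot02 hf
  have h12 := rot12 hf
  have n01 := neg _ h01
  have n02 := neg _ h02
  have n12 := neg _ h12
  simp only [neg_mul, one_mul, neg_sub] at n01 n02 n12
  fin_cases i <;> fin_cases k <;> simp only [Fin.mk_zero, Fin.zero_eta, Fin.mk_one, Fin.reduceFinMk] <;>
    first | assumption | (simp [sI_eq])

lemma rot_main {i j k : Fin 3} (hij : i ≠ j) (hjk : j ≠ k) (hik : i ≠ k) (p : ℕ) (c ε : ℝ)
    (hε : 0 < ε) (q : ℝ → ℝ) (hq : ContDiff ℝ 1 q) :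
    sphereIntegral (fun m => ((p + 1) * m i ^ p * m k ^ 2 - m i ^ (p + 2)
      - 2 * c * m i ^ (p + 2) * m k ^ 2) * Real.exp (-c * m i ^ 2) *
        (q (m j) / (m i ^ 2 + m k ^ 2 + ε))) = 0 := by
  set f : (Fin 3 → ℝ) → ℝ := fun m => (m i ^ (p+1) * m k) * Real.exp (-c * m i ^ 2) *
        (q (m j) / (m i ^ 2 + m k ^ 2 + ε)) with hfdef
  have hpos : ∀ m : Fin 3 → ℝ, m i ^ 2 + m k ^ 2 + ε ≠ 0 := fun m => by positivity
  have hf : ContDiff ℝ 1 f := by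
    have hqj : ContDiff ℝ 1 (fun m : Fin 3 → ℝ => q (m j)) := hq.comp (by fun_prop)
    refine ContDiff.mul (by fun_prop) (ContDiff.div hqj (by fun_prop) hpos)
  rw [← rot_all hf i k]
  congr 1; ext m
  set v : Fin 3 → ℝ := m k • Pi.single i 1 - m i • Pi.single k 1 with hv
  have hline : HasDerivAt (fun t : ℝ => f (m + t • v)) (fderiv ℝ f m v) 0 := by
    have h1 : HasDerivAt (fun t : ℝ => m + t • v) v 0 := by
      simpa using ((hasDerivAt_id (0:ℝ)).smul_const v).const_add m
    have h2 : HasDerivAt (fun t : ℝ => f (m + t • v)) _ 0 :=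
      HasFDerivAt.comp_hasDerivAt (l := f) (0:ℝ)
        ((hf.differentiable (by norm_num)) (m + (0:ℝ) • v)).hasFDerivAt h1
    convert h2 using 1
    simp
  have hvv : fderiv ℝ f m v = m k * fderiv ℝ f m (Pi.single i 1)
    - m i * fderiv ℝ f m (Pi.single k 1) := by
    rw [hv, map_sub, map_smul, map_smul]; simp
  rw [← hvv]
  have hU : HasDerivAt (fun t : ℝ => m i + t * m k) (m k) 0 := by
    simpa using ((hasDerivAt_id (0:ℝ)).mul_const (m k)).const_add (m i)
  have hV : HasDerivAt (fun t : ℝ => m k + t * (- m i)) (- m i) 0 := by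
    simpa using ((hasDerivAt_id (0:ℝ)).mul_const (- m i)).const_add (m k)
  have hE := ((hU.pow 2).const_mul (-c)).exp
  have hR := (((hU.pow 2).add (hV.pow 2)).add_const ε)
  have hR' := (hasDerivAt_const (0:ℝ) (q (m j))).div hR (by simpa using hpos m)
  have hT := (((hU.pow (p+1)).mul hV).mul hE).mul hR'
  have hfe : (fun t : ℝ => f (m + t • v)) = fun t => ((m i + t * m k) ^ (p+1) * (m k + t * (- m i)))
      * Real.exp (-c * (m i + t * m k) ^ 2) *
        (q (m j) / ((m i + t * m k) ^ 2 + (m k + t * (- m i)) ^ 2 + ε)) := by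
    ext t
    simp [hfdef, hv, hij, hjk, hik, hij.symm, hjk.symm, hik.symm]
  rw [hfe] at hline
  have := hline.unique hT
  rw [this]
  have hp := hpos m
  simp
  field_simp
  ring
lemma sum3 {i j k : Fin 3} (hij : i ≠ j) (hjk : j ≠ k) (hik : i ≠ k) (g : Fin 3 → ℝ) :
    ∑ l, g l = g i + g j + g k := by
  rw [Fin.sum_univ_three]
  revert hij hjk hik
  fin_cases i <;> fin_cases j <;> fin_cases k <;> simp <;> ring

lemma ptA {u v ε a T E E0 : ℝ} (ha : 0 ≤ a) (hε : 0 < ε) (hT : 0 ≤ T)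
    (hE : E = Real.exp (-a * u ^ 2)) (hE0 : E0 = Real.exp (-(a * (3/4) * (u ^ 2 + v ^ 2)))) :
    2 * ((v ^ 2 - u ^ 2 - 2 * a * u ^ 2 * v ^ 2) * E * T)
      + a * ((3 * u ^ 2 * v ^ 2 - u ^ 4) * E0 * T) ≤
    (2 + a * ε - a * u ^ 2) * (T * (u ^ 2 + v ^ 2 + ε)) * E := by
  have hEp : 0 < E := hE ▸ Real.exp_pos _
  have key : 0 ≤ (3 * v ^ 2 - u ^ 2) * (E - E0) := by
    rcases le_total (u ^ 2) (3 * v ^ 2) with h | h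
    · apply mul_nonneg (by linarith)
      rw [hE, hE0, sub_nonneg, Real.exp_le_exp]; nlinarith
    · apply mul_nonneg_of_nonpos_of_nonpos (by linarith)
      rw [hE, hE0, sub_nonpos, Real.exp_le_exp]; nlinarith
  have h1 : 0 ≤ a * u ^ 2 * T * ((3 * v ^ 2 - u ^ 2) * (E - E0)) := by positivity
  have h2 : 0 ≤ (4 * u ^ 2 + ε * (2 + a * ε) + a * ε * v ^ 2) * (E * T) := by positivity
  nlinarith

lemma ptB {u v ε a T E E0 : ℝ} (ha : 0 ≤ a) (hε : 0 < ε) (hT : 0 ≤ T)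
    (hE : E = Real.exp (-a * u ^ 2)) (hE0 : E0 = Real.exp (-(a * (5/6) * (u ^ 2 + v ^ 2)))) :
    3 * ((3 * u ^ 2 * v ^ 2 - u ^ 4 - 2 * a * u ^ 4 * v ^ 2) * E * T)
      + a * ((5 * u ^ 4 * v ^ 2 - u ^ 6) * E0 * T) ≤
    (9 + a * ε - a * u ^ 2) * u ^ 2 * (T * (u ^ 2 + v ^ 2 + ε)) * E := by
  have hEp : 0 < E := hE ▸ Real.exp_pos _
  have key : 0 ≤ (5 * v ^ 2 - u ^ 2) * (E - E0) := by
    rcases le_total (u ^ 2) (5 * v ^ 2) with h | h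
    · apply mul_nonneg (by linarith)
      rw [hE, hE0, sub_nonneg, Real.exp_le_exp]; nlinarith
    · apply mul_nonneg_of_nonpos_of_nonpos (by linarith)
      rw [hE, hE0, sub_nonpos, Real.exp_le_exp]; nlinarith
  have h1 : 0 ≤ a * u ^ 4 * T * ((5 * v ^ 2 - u ^ 2) * (E - E0)) := by positivity
  have h2 : 0 ≤ u ^ 2 * (12 * u ^ 2 + ε * (9 + a * ε) + a * ε * v ^ 2) * (E * T) := by positivity
  nlinarith

lemma eps_lim {a J K C : ℝ} (h : ∀ ε : ℝ, 0 < ε → a * J ≤ (C + a * ε) * K) :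
    a * J ≤ C * K := by
  have ht : Tendsto (fun ε : ℝ => (C + a * ε) * K) (nhdsWithin 0 (Set.Ioi 0)) (nhds ((C + a * 0) * K)) :=
    (Continuous.tendsto (by fun_prop) 0).mono_left nhdsWithin_le_nhds
  have := ge_of_tendsto ht (eventually_nhdsWithin_of_forall fun ε hε => h ε hε)
  simpa using this

section claims
variable {i j k : Fin 3} (hij : i ≠ j) (hjk : j ≠ k) (hik : i ≠ k) {a : ℝ} (ha : 0 ≤ a)
  {q : ℝ → ℝ} (hq : ContDiff ℝ 1 q) (hq0 : ∀ y, 0 ≤ q y)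

lemma claimA (hij : i ≠ j) (hjk : j ≠ k) (hik : i ≠ k) (ha : 0 ≤ a)
    (hq : ContDiff ℝ 1 q) (hq0 : ∀ y, 0 ≤ q y) :
    a * sphereIntegral (fun m => m i ^ 2 * q (m j) * Real.exp (-a * m i ^ 2)) ≤
    2 * sphereIntegral (fun m => q (m j) * Real.exp (-a * m i ^ 2)) := by
  apply eps_lim
  intro ε hε
  have hqc := hq.continuous
  have h1 := rot_main hij hjk hik 0 a ε hε q hq
  have h2 := rot_main hij hjk hik 2 0 ε hε (fun y => q y * Real.exp (-(a * (3/4) * (1 - y ^ 2))))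
    (by fun_prop)
  have hp : ∀ m : Fin 3 → ℝ, m i ^ 2 + m k ^ 2 + ε ≠ 0 := fun m => by positivity
  have c1 : Continuous (fun m : Fin 3 → ℝ => q (m j) / (m i ^ 2 + m k ^ 2 + ε)) :=
    Continuous.div (by fun_prop) (by fun_prop) hp
  have c2 : Continuous (fun m : Fin 3 → ℝ =>
    q (m j) * Real.exp (-(a * (3/4) * (1 - m j ^ 2))) / (m i ^ 2 + m k ^ 2 + ε)) :=
    Continuous.div (by fun_prop) (by fun_prop) hp
  have h3 := congrArg₂ (fun x y => 2 * x + a * y) h1 h2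
  beta_reduce at h3
  rw [← sI_mul, ← sI_mul, ← sI_add (by fun_prop) (by fun_prop)] at h3
  rw [← sI_mul, ← sI_mul, ← sub_nonneg, sub_eq_add_neg, ← neg_one_mul (sphereIntegral _), ← sI_mul,
    ← sI_add (by fun_prop) (by fun_prop)]
  have h0 : (0:ℝ) = 2 * 0 + a * 0 := by ring
  rw [h0, ← h3]
  apply sI_mono (by fun_prop) (by fun_prop)
  intro m hm
  rw [sum3 hij hjk hik] at hm
  have hT : 0 ≤ q (m j) / (m i ^ 2 + m k ^ 2 + ε) := div_nonneg (hq0 _) (by positivity)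
  have := ptA (u := m i) (v := m k) ha hε hT rfl rfl
  rw [div_mul_cancel₀ _ (hp m)] at this
  have e : 1 - m j ^ 2 = m i ^ 2 + m k ^ 2 := by linarith
  rw [e]
  refine (le_of_eq ?_).trans (this.trans (le_of_eq ?_))
  · rw [neg_zero, zero_mul, Real.exp_zero]; push_cast; ring
  · ring

lemma claimB (hij : i ≠ j) (hjk : j ≠ k) (hik : i ≠ k) (ha : 0 ≤ a)
    (hq : ContDiff ℝ 1 q) (hq0 : ∀ y, 0 ≤ q y) :
    a * sphereIntegral (fun m => m i ^ 4 * q (m j) * Real.exp (-a * m i ^ 2)) ≤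
    9 * sphereIntegral (fun m => m i ^ 2 * q (m j) * Real.exp (-a * m i ^ 2)) := by
  apply eps_lim
  intro ε hε
  have hqc := hq.continuous
  have h1 := rot_main hij hjk hik 2 a ε hε q hq
  have h2 := rot_main hij hjk hik 4 0 ε hε (fun y => q y * Real.exp (-(a * (5/6) * (1 - y ^ 2))))
    (by fun_prop)
  have hp : ∀ m : Fin 3 → ℝ, m i ^ 2 + m k ^ 2 + ε ≠ 0 := fun m => by positivity
  have c1 : Continuous (fun m : Fin 3 → ℝ => q (m j) / (m i ^ 2 + m k ^ 2 + ε)) :=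
    Continuous.div (by fun_prop) (by fun_prop) hp
  have c2 : Continuous (fun m : Fin 3 → ℝ =>
    q (m j) * Real.exp (-(a * (5/6) * (1 - m j ^ 2))) / (m i ^ 2 + m k ^ 2 + ε)) :=
    Continuous.div (by fun_prop) (by fun_prop) hp
  have h3 := congrArg₂ (fun x y => 3 * x + a * y) h1 h2
  beta_reduce at h3
  rw [← sI_mul, ← sI_mul, ← sI_add (by fun_prop) (by fun_prop)] at h3
  rw [← sI_mul, ← sI_mul, ← sub_nonneg, sub_eq_add_neg, ← neg_one_mul (sphereIntegral _), ← sI_mul,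
    ← sI_add (by fun_prop) (by fun_prop)]
  have h0 : (0:ℝ) = 3 * 0 + a * 0 := by ring
  rw [h0, ← h3]
  apply sI_mono (by fun_prop) (by fun_prop)
  intro m hm
  rw [sum3 hij hjk hik] at hm
  have hT : 0 ≤ q (m j) / (m i ^ 2 + m k ^ 2 + ε) := div_nonneg (hq0 _) (by positivity)
  have := ptB (u := m i) (v := m k) ha hε hT rfl rfl
  rw [div_mul_cancel₀ _ (hp m)] at this
  have e : 1 - m j ^ 2 = m i ^ 2 + m k ^ 2 := by linarith
  rw [e]
  refine (le_of_eq ?_).trans (this.trans (le_of_eq ?_))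
  · rw [neg_zero, zero_mul, Real.exp_zero]; push_cast; ring
  · ring
end claims

/-- Unnormalised moments. -/
noncomputable def wt (μ : Fin 3 → ℝ) (m : Fin 3 → ℝ) : ℝ := Real.exp (∑ l, μ l * m l ^ 2)

@[fun_prop]
lemma wt_cont (μ : Fin 3 → ℝ) : Continuous (wt μ) := by unfold wt; fun_prop

lemma wt_pos (μ m : Fin 3 → ℝ) : 0 < wt μ m := Real.exp_pos _

noncomputable def NN (μ : Fin 3 → ℝ) : ℝ := sphereIntegral (wt μ)
noncomputable def AA (μ : Fin 3 → ℝ) (i : Fin 3) : ℝ := sphereIntegral (fun m => m i ^ 2 * wt μ m)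

noncomputable def MM (μ : Fin 3 → ℝ) (i j : Fin 3) : ℝ :=
  sphereIntegral (fun m => m i ^ 2 * m j ^ 2 * wt μ m)

lemma NN_pos (μ : Fin 3 → ℝ) : 0 < NN μ :=
  sI_pos (wt_cont μ) (fun m => (wt_pos μ m).le) (fun m _ => wt_pos μ m)

lemma AA_pos (μ : Fin 3 → ℝ) (i : Fin 3) : 0 < AA μ i := by
  apply sI_pos (by fun_prop)
  · intro m; have := wt_pos μ m; positivity
  · intro m h; have := wt_pos μ m; have := h i; positivity

lemma MM_nonneg (μ : Fin 3 → ℝ) (i j : Fin 3) : 0 ≤ MM μ i j := by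
  have : sphereIntegral (fun m => 0 * wt μ m) = 0 := by rw [sI_mul, zero_mul]
  rw [← this]
  apply sI_mono (by fun_prop) (by fun_prop)
  intro m _; have := wt_pos μ m; simp; positivity

lemma MM_comm (μ : Fin 3 → ℝ) (i j : Fin 3) : MM μ i j = MM μ j i := by
  unfold MM; congr 1; ext m; ring

lemma AA_sum (μ : Fin 3 → ℝ) : ∑ i, AA μ i = NN μ := by
  unfold AA NN
  rw [Fin.sum_univ_three, ← sI_add (by fun_prop) (by fun_prop), ← sI_add (by fun_prop) (by fun_prop)]
  apply sI_congr
  intro m hm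
  rw [Fin.sum_univ_three] at hm
  linear_combination wt μ m * hm

lemma MM_sum (μ : Fin 3 → ℝ) (i : Fin 3) : ∑ j, MM μ i j = AA μ i := by
  unfold AA MM
  rw [Fin.sum_univ_three, ← sI_add (by fun_prop) (by fun_prop), ← sI_add (by fun_prop) (by fun_prop)]
  apply sI_congr
  intro m hm
  rw [Fin.sum_univ_three] at hm
  linear_combination m i ^ 2 * wt μ m * hm

section core
variable {i j k : Fin 3} 

lemma wt_eq (hij : i ≠ j) (hjk : j ≠ k) (hik : i ≠ k) (μ m : Fin 3 → ℝ) (hm : ∑ l, m l ^ 2 = 1) :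
    wt μ m = Real.exp (μ k + (μ j - μ k) * m j ^ 2) * Real.exp (-(μ k - μ i) * m i ^ 2) := by
  rw [wt, ← Real.exp_add, sum3 hij hjk hik]
  rw [sum3 hij hjk hik] at hm
  congr 1
  linear_combination μ k * hm

lemma ident (hij : i ≠ j) (hjk : j ≠ k) (hik : i ≠ k) (μ : Fin 3 → ℝ) :
    AA μ k - AA μ i = 2 * (μ k - μ i) * MM μ i k := by
  have h := rot_main hij hjk hik 0 (μ k - μ i) 1 one_pos
    (fun y => (1 - y ^ 2 + 1) * Real.exp (μ k + (μ j - μ k) * y ^ 2)) (by fun_prop)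
  have h' : sphereIntegral (fun m => m k ^ 2 * wt μ m + (-1 * (m i ^ 2 * wt μ m)
      + (-(2 * (μ k - μ i))) * (m i ^ 2 * m k ^ 2 * wt μ m))) = 0 := by
    rw [← h]
    apply sI_congr
    intro m hm
    rw [wt_eq hij hjk hik μ m hm]
    rw [sum3 hij hjk hik] at hm
    have e : 1 - m j ^ 2 = m i ^ 2 + m k ^ 2 := by linarith
    rw [e]
    have hp : m i ^ 2 + m k ^ 2 + 1 ≠ 0 := by positivity
    field_simp
    simp
    ring
  rw [sI_add (by fun_prop) (by fun_prop), sI_add (by fun_prop) (by fun_prop), sI_mul, sI_mul] at h'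
  unfold AA MM
  linarith

lemma clA (hij : i ≠ j) (hjk : j ≠ k) (hik : i ≠ k) (μ : Fin 3 → ℝ) (h : μ i ≤ μ k) :
    (μ k - μ i) * MM μ i j ≤ 2 * AA μ j := by
  have := claimA hij hjk hik (sub_nonneg.2 h)
    (q := fun y => y ^ 2 * Real.exp (μ k + (μ j - μ k) * y ^ 2)) (by fun_prop)
    (fun y => by positivity)
  convert this using 2
  · apply sI_congr
    intro m hm
    rw [wt_eq hij hjk hik μ m hm]; ring
  · apply sI_congr
    intro m hm
    rw [wt_eq hij hjk hik μ m hm]; ring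

lemma clB (hij : i ≠ j) (hjk : j ≠ k) (hik : i ≠ k) (μ : Fin 3 → ℝ) (h : μ i ≤ μ k) :
    (μ k - μ i) * MM μ i i ≤ 9 * AA μ i := by
  have := claimB hij hjk hik (sub_nonneg.2 h)
    (q := fun y => Real.exp (μ k + (μ j - μ k) * y ^ 2)) (by fun_prop)
    (fun y => by positivity)
  convert this using 2
  · apply sI_congr
    intro m hm
    rw [wt_eq hij hjk hik μ m hm]; ring
  · apply sI_congr
    intro m hm
    rw [wt_eq hij hjk hik μ m hm]; ring

lemma core (hij : i ≠ j) (hjk : j ≠ k) (hik : i ≠ k) (μ : Fin 3 → ℝ) (h : μ i ≤ μ k)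
    (h' : μ j ≤ μ k) :
    -19 * AA μ i ≤ NN μ - 2 * (μ k - μ i) * AA μ i ∧
    NN μ - 2 * (μ k - μ i) * AA μ i ≤ 3 * AA μ i := by
  have e1 := ident hij hjk hik μ
  have e2 := ident hik hjk.symm hij μ
  have e3 := MM_sum μ i
  have e4 := AA_sum μ
  rw [sum3 hij hjk hik] at e3 e4
  have a1 := clA hij.symm hik hjk μ h'
  have b1 := clB hij hjk hik μ h
  rw [MM_comm] at a1
  have p1 := mul_nonneg (sub_nonneg.2 h') (MM_nonneg μ i j)
  have p2 := mul_nonneg (sub_nonneg.2 h) (MM_nonneg μ i i)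
  have E : NN μ - 2 * (μ k - μ i) * AA μ i = 3 * AA μ i - 2 * ((μ k - μ i) * MM μ i i)
     - 2 * ((μ k - μ j) * MM μ i j) := by
    linear_combination e1 + e2 - e4 + 2 * (μ k - μ i) * e3
  rw [E]
  constructor <;> linarith

lemma AA_le (hij : i ≠ j) (hjk : j ≠ k) (hik : i ≠ k) (μ : Fin 3 → ℝ) (h : μ i ≤ μ k) :
    AA μ i ≤ AA μ k := by
  have e1 := ident hij hjk hik μ
  have := mul_nonneg (sub_nonneg.2 h) (MM_nonneg μ i k)
  linarith
end core
lemma Z_eq (μ : Fin 3 → ℝ) : binghamZ μ = NN μ / (4 * Real.pi) := by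
  unfold binghamZ NN wt; ring

lemma z_eq (μ : Fin 3 → ℝ) (i : Fin 3) : binghamZ2 μ i = AA μ i / NN μ := by
  have h := NN_pos μ
  have hpi := Real.pi_pos
  unfold binghamZ2
  rw [Z_eq, show sphereIntegral (fun m => (m i) ^ 2 * Real.exp (∑ j, μ j * (m j) ^ 2)) = AA μ i from rfl]
  field_simp

lemma z_pos (μ : Fin 3 → ℝ) (i : Fin 3) : 0 < binghamZ2 μ i := by
  rw [z_eq]; exact div_pos (AA_pos μ i) (NN_pos μ)

lemma z_sum (μ : Fin 3 → ℝ) : ∑ i, binghamZ2 μ i = 1 := by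
  simp only [z_eq]
  rw [← Finset.sum_div, AA_sum, div_self (NN_pos μ).ne']

lemma third (i k : Fin 3) (h : i ≠ k) : ∃ j, i ≠ j ∧ j ≠ k := by
  revert i k; decide

lemma core_z {i k : Fin 3} (hik : i ≠ k) (μ : Fin 3 → ℝ) (hmax : ∀ l, μ l ≤ μ k) :
    -19 * binghamZ2 μ i ≤ 1 - 2 * (μ k - μ i) * binghamZ2 μ i ∧
    1 - 2 * (μ k - μ i) * binghamZ2 μ i ≤ 3 * binghamZ2 μ i := by
  obtain ⟨j, hij, hjk⟩ := third i k hik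
  obtain ⟨h1, h2⟩ := core hij hjk hik μ (hmax i) (hmax j)
  have hN := NN_pos μ
  rw [z_eq]
  have e : 1 - 2 * (μ k - μ i) * (AA μ i / NN μ) = (NN μ - 2 * (μ k - μ i) * AA μ i) / NN μ := by
    field_simp
  rw [e, ← mul_div_assoc, ← mul_div_assoc]
  exact ⟨div_le_div_of_nonneg_right h1 hN.le, div_le_div_of_nonneg_right h2 hN.le⟩

lemma g_bound (μ : Fin 3 → ℝ) : ∃ s : ℝ, ∀ i, |μ i + 1 / (2 * binghamZ2 μ i) - s| ≤ 10 := by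
  obtain ⟨k, hk⟩ := Finite.exists_max μ
  refine ⟨μ k, fun i => ?_⟩
  have hz := z_pos μ i
  by_cases hik : i = k
  · subst hik
    have h3 : 1 / 3 ≤ binghamZ2 μ i := by
      have hall : ∀ l, binghamZ2 μ l ≤ binghamZ2 μ i := by
        intro l
        by_cases hl : l = i
        · rw [hl]
        obtain ⟨j, h1, h2⟩ := third l i hl
        rw [z_eq, z_eq]
        exact div_le_div_of_nonneg_right (AA_le h1 h2 hl μ (hk l)) (NN_pos μ).le
      have hs := z_sum μ
      rw [Fin.sum_univ_three] at hs
      have := hall 0; have := hall 1; have := hall 2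
      linarith
    have h4 : 1 / (2 * binghamZ2 μ i) ≤ 10 := by
      rw [div_le_iff₀ (by positivity)]; linarith
    have h5 : 0 < 1 / (2 * binghamZ2 μ i) := by positivity
    rw [abs_le]; constructor <;> linarith
  · obtain ⟨h1, h2⟩ := core_z hik μ hk
    have e : μ i + 1 / (2 * binghamZ2 μ i) - μ k =
      (1 - 2 * (μ k - μ i) * binghamZ2 μ i) / (2 * binghamZ2 μ i) := by
      field_simp; ring
    rw [e, abs_le, div_le_iff₀ (by positivity), le_div_iff₀ (by positivity)]
    constructor <;> linarith

lemma jensen (μ ν : Fin 3 → ℝ) :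
    Real.log (NN μ) + ∑ i, (ν i - μ i) * binghamZ2 μ i ≤ Real.log (NN ν) := by
  have hN := NN_pos μ
  set c := ∑ i, (ν i - μ i) * binghamZ2 μ i with hc
  rw [Real.le_log_iff_exp_le (NN_pos ν), Real.exp_add, Real.exp_log hN]
  have hcN : c * NN μ = (ν 0 - μ 0) * AA μ 0 + (ν 1 - μ 1) * AA μ 1 + (ν 2 - μ 2) * AA μ 2 := by
    rw [hc, Fin.sum_univ_three]
    simp only [z_eq]
    field_simp
  have key : sphereIntegral (fun m => Real.exp c * ((1 - c) * wt μ m +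
      ((ν 0 - μ 0) * (m 0 ^ 2 * wt μ m) + ((ν 1 - μ 1) * (m 1 ^ 2 * wt μ m)
       + (ν 2 - μ 2) * (m 2 ^ 2 * wt μ m))))) = NN μ * Real.exp c := by
    rw [sI_mul, sI_add (by fun_prop) (by fun_prop), sI_add (by fun_prop) (by fun_prop),
      sI_add (by fun_prop) (by fun_prop), sI_mul, sI_mul, sI_mul, sI_mul]
    change Real.exp c * ((1 - c) * NN μ + ((ν 0 - μ 0) * AA μ 0 + ((ν 1 - μ 1) * AA μ 1 +
      (ν 2 - μ 2) * AA μ 2))) = _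
    linear_combination (-Real.exp c) * hcN
  rw [← key]
  apply sI_mono (by fun_prop) (by fun_prop)
  intro m _
  have hw := wt_pos μ m
  set x := (ν 0 - μ 0) * m 0 ^ 2 + (ν 1 - μ 1) * m 1 ^ 2 + (ν 2 - μ 2) * m 2 ^ 2 with hx
  have e1 : wt ν m = wt μ m * (Real.exp c * Real.exp (x - c)) := by
    unfold wt
    rw [← Real.exp_add, ← Real.exp_add]
    congr 1
    simp only [Fin.sum_univ_three, hx]; ring
  have h1 := Real.add_one_le_exp (x - c)
  have h2 : 0 ≤ wt μ m * Real.exp c := by positivity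
  have h3 := mul_le_mul_of_nonneg_left h1 h2
  rw [e1]
  calc _ = wt μ m * Real.exp c * (x - c + 1) := by rw [hx]; ring
    _ ≤ _ := h3
    _ = _ := by ring

lemma sI_param {F : (Fin 3 → ℝ) → (Fin 3 → ℝ) → ℝ}
    (hF : Continuous (fun p : (Fin 3 → ℝ) × (Fin 3 → ℝ) => F p.1 p.2)) :
    Continuous (fun μ => sphereIntegral (F μ)) := by
  simp only [sI_eq]
  apply intervalIntegral.continuous_parametric_intervalIntegral_of_continuous'
  have h := intervalIntegral.continuous_parametric_intervalIntegral_of_continuous'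
    (f := fun (x : (Fin 3 → ℝ) × ℝ) (φ : ℝ) => F x.1 (sph x.2 φ) * Real.sin x.2)
    (μ := MeasureTheory.volume) (by
      have : Continuous (fun x : ((Fin 3 → ℝ) × ℝ) × ℝ => (x.1.1, sph x.1.2 x.2)) := by fun_prop
      exact (hF.comp this).mul (by fun_prop)) 0 (2 * Real.pi)
  exact h

lemma NN_cont : Continuous NN := by
  unfold NN
  apply sI_param
  unfold wt; fun_prop

lemma z_cont (i : Fin 3) : Continuous (fun μ => binghamZ2 μ i) := by
  simp only [z_eq]
  refine Continuous.div ?_ NN_cont (fun μ => (NN_pos μ).ne')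
  unfold AA
  apply sI_param
  unfold wt; fun_prop

lemma vertex (k : Fin 3) {δ : ℝ} (hδ : 0 < δ) : ∃ ν : Fin 3 → ℝ, ∀ i, i ≠ k → binghamZ2 ν i ≤ δ := by
  set t := (1 / δ + 19) / 2 with ht
  have ht0 : 0 ≤ t := by positivity
  refine ⟨Function.update 0 k t, fun i hi => ?_⟩
  have h := (core_z hi (Function.update 0 k t) (by
    intro l
    by_cases hl : l = k
    · rw [hl]
    · simp [hl, ht0])).1
  simp [hi] at h
  set z := binghamZ2 (Function.update 0 k t) i
  have : z * (1 / δ) ≤ 1 := by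
    have e : 1 / δ = 2 * t - 19 := by rw [ht]; ring
    rw [e]; linarith
  rw [mul_one_div, div_le_one hδ] at this
  exact this

lemma lower (q : Fin 3 → ℝ) (hs : ∑ i, q i = 1) {δ : ℝ} (hδ : 0 < δ) (hq : ∀ i, δ ≤ q i)
    (k : Fin 3) : ∃ C : ℝ, ∀ μ : Fin 3 → ℝ, (∀ l, μ l ≤ μ k) →
      C + δ / 2 * ∑ i, (μ k - μ i) ≤ Real.log (NN μ) - ∑ i, μ i * q i := by
  obtain ⟨ν, hν⟩ := vertex k (half_pos hδ)
  refine ⟨Real.log (NN ν) - ∑ i, ν i * binghamZ2 ν i, fun μ hμ => ?_⟩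
  have hj := jensen ν μ
  have hz := z_sum ν
  have h : δ / 2 * ∑ i, (μ k - μ i) ≤ ∑ i, (μ k - μ i) * (q i - binghamZ2 ν i) := by
    rw [Finset.mul_sum]
    apply Finset.sum_le_sum
    intro i _
    by_cases hi : i = k
    · simp [hi]
    · have := hν i hi
      have := hq i
      have := hμ i
      nlinarith
  simp only [Fin.sum_univ_three] at *
  have e : (μ k - μ 0) * (q 0 - binghamZ2 ν 0) + (μ k - μ 1) * (q 1 - binghamZ2 ν 1) + (μ k - μ 2) * (q 2 - binghamZ2 ν 2)
    = μ 0 * (binghamZ2 ν 0 - q 0) + μ 1 * (binghamZ2 ν 1 - q 1) + μ 2 * (binghamZ2 ν 2 - q 2) := by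
    linear_combination μ k * hs - μ k * hz
  linarith

lemma surj (q : Fin 3 → ℝ) (hs : ∑ i, q i = 1) (hq : ∀ i, 0 < q i) :
    ∃ μ : Fin 3 → ℝ, ∀ i, binghamZ2 μ i = q i := by
  obtain ⟨k0, hk0⟩ := Finite.exists_min q
  have hδ := hq k0
  choose C hC using lower q hs hδ hk0
  set emb : ℝ × ℝ → (Fin 3 → ℝ) := fun x => ![x.1, x.2, 0] with hemb
  have embc : Continuous emb := by
    refine continuous_pi fun i => ?_
    fin_cases i <;> simp [hemb] <;> fun_prop
  set H : ℝ × ℝ → ℝ := fun x => Real.log (NN (emb x)) - ∑ i, emb x i * q i with hH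
  have Hc : Continuous H := by
    refine Continuous.sub (Continuous.log (NN_cont.comp embc) fun x => (NN_pos _).ne') ?_
    fun_prop
  have Hlow : ∀ x, -(∑ k, |C k|) + q k0 / 2 * ‖x‖ ≤ H x := by
    intro x
    obtain ⟨k, hk⟩ := Finite.exists_max (emb x)
    have h1 := hC k (emb x) hk
    have h2 : -(∑ k, |C k|) ≤ C k := by
      have := Finset.single_le_sum (f := fun k => |C k|) (fun i _ => abs_nonneg _) (Finset.mem_univ k)
      have := neg_abs_le (C k)
      linarith
    have h3 : ‖x‖ ≤ ∑ i, (emb x k - emb x i) := by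
      have k0 := hk 0
      have k1 := hk 1
      have k2 := hk 2
      rw [Fin.sum_univ_three]
      generalize emb x k = M at *
      simp [hemb] at k0 k1 k2 ⊢
      rw [Prod.norm_def, max_le_iff, Real.norm_eq_abs, Real.norm_eq_abs, abs_le, abs_le]
      refine ⟨⟨?_, ?_⟩, ?_, ?_⟩ <;> linarith
    have h4 := mul_le_mul_of_nonneg_left h3 (half_pos hδ).le
    simp only [hH]
    linarith
  have Ht : Tendsto H (cocompact (ℝ × ℝ)) atTop := by
    refine tendsto_atTop_mono Hlow ?_
    apply tendsto_atTop_add_const_left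
    exact (tendsto_norm_cocompact_atTop).const_mul_atTop (half_pos hδ)
  obtain ⟨x, hx⟩ := Hc.exists_forall_le Ht
  have key : ∀ (v : ℝ × ℝ) (i : Fin 3), (∀ t : ℝ, emb (x + t • v) = fun l => emb x l + t * (Pi.single i 1 : Fin 3 → ℝ) l) →
      binghamZ2 (emb x) i = q i := by
    intro v i hv
    have hineq : ∀ t : ℝ, t * q i ≤ t * binghamZ2 (emb (x + t • v)) i := by
      intro t
      have h1 := jensen (emb (x + t • v)) (emb x)
      have h2 := hx (x + t • v)
      simp only [hH] at h2
      have e1 : ∑ l, (emb x l - emb (x + t • v) l) * binghamZ2 (emb (x + t • v)) l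
          = - (t * binghamZ2 (emb (x + t • v)) i) := by
        rw [Finset.sum_eq_single i]
        · rw [hv t]; simp
        · intro b _ hb
          simp [hv t, hb]
        · simp
      have e2 : ∑ l, emb (x + t • v) l * q l = ∑ l, emb x l * q l + t * q i := by
        simp only [hv t, add_mul, Finset.sum_add_distrib]
        congr 1
        rw [Finset.sum_eq_single i]
        · simp
        · intro b _ hb
          simp [hb]
        · simp
      rw [e1] at h1
      rw [e2] at h2
      linarith
    have hcz : Continuous (fun t : ℝ => binghamZ2 (emb (x + t • v)) i) :=
      (z_cont i).comp (embc.comp (by fun_prop))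
    have h0 : Tendsto (fun t : ℝ => binghamZ2 (emb (x + t • v)) i) (nhds 0) (nhds (binghamZ2 (emb x) i)) := by
      have := hcz.tendsto 0
      simpa using this
    apply le_antisymm
    · refine le_of_tendsto (h0.mono_left (nhdsWithin_le_nhds (s := Set.Iio 0))) ?_
      refine eventually_nhdsWithin_of_forall fun t ht => ?_
      have := hineq t
      rw [Set.mem_Iio] at ht
      nlinarith [mul_le_mul_left_of_neg ht (a := binghamZ2 (emb (x + t • v)) i) (b := q i)]
    · refine ge_of_tendsto (h0.mono_left (nhdsWithin_le_nhds (s := Set.Ioi 0))) ?_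
      refine eventually_nhdsWithin_of_forall fun t ht => ?_
      exact le_of_mul_le_mul_left (hineq t) ht
  have k0 := key (1, 0) 0 (by
    intro t; ext l; fin_cases l <;> simp [hemb])
  have k1 := key (0, 1) 1 (by
    intro t; ext l; fin_cases l <;> simp [hemb])
  refine ⟨emb x, ?_⟩
  have hz := z_sum (emb x)
  rw [Fin.sum_univ_three] at hz hs
  intro i
  fin_cases i
  · exact k0
  · exact k1
  · simp; linarith

lemma one_side (μ ν : Fin 3 → ℝ) {ε : ℝ} (hε : 0 < ε) (h1 : ∀ i, ε ≤ binghamZ2 μ i)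
    (h2 : ∀ i, ε ≤ binghamZ2 ν i) :
    -(10 * (∑ i, |binghamZ2 μ i - binghamZ2 ν i|) + 1 / (2 * ε ^ 2) *
      ∑ i, (binghamZ2 μ i - binghamZ2 ν i) ^ 2) ≤ correction3d ν - correction3d μ := by
  obtain ⟨s, hs⟩ := g_bound μ
  have hj := jensen ν μ
  have hpi := Real.pi_pos
  have L : ∀ i, (binghamZ2 ν i - binghamZ2 μ i) / binghamZ2 μ i
      - (binghamZ2 μ i - binghamZ2 ν i) ^ 2 / ε ^ 2 ≤
      Real.log (binghamZ2 ν i) - Real.log (binghamZ2 μ i) := by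
    intro i
    have hz := z_pos μ i
    have hw := z_pos ν i
    have e1 := h1 i
    have e2 := h2 i
    generalize binghamZ2 μ i = z at *
    generalize binghamZ2 ν i = w at *
    have l1 := Real.log_le_sub_one_of_pos (div_pos hz hw)
    rw [Real.log_div hz.ne' hw.ne'] at l1
    have e3 : (z - w) ^ 2 / (z * w) ≤ (z - w) ^ 2 / ε ^ 2 := by
      apply div_le_div_of_nonneg_left (by positivity) (by positivity)
      rw [sq]; exact mul_le_mul e1 e2 hε.le hz.le
    have e4 : (w - z) / z - (z - w) ^ 2 / (z * w) = 1 - z / w := by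
      field_simp; ring
    linarith
  have hzs := z_sum μ
  have hws := z_sum ν
  have G : ∀ i, -(10 * |binghamZ2 μ i - binghamZ2 ν i|) ≤
      (μ i + 1 / (2 * binghamZ2 μ i) - s) * (binghamZ2 ν i - binghamZ2 μ i) := by
    intro i
    have := neg_abs_le ((μ i + 1 / (2 * binghamZ2 μ i) - s) * (binghamZ2 ν i - binghamZ2 μ i))
    rw [abs_mul, abs_sub_comm (binghamZ2 ν i)] at this
    have h3 := mul_le_mul_of_nonneg_right (hs i) (abs_nonneg (binghamZ2 μ i - binghamZ2 ν i))
    linarith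
  have G' : ∀ i, (μ i + 1 / (2 * binghamZ2 μ i) - s) * (binghamZ2 ν i - binghamZ2 μ i) =
     (μ i - s) * (binghamZ2 ν i - binghamZ2 μ i) + 1 / 2 * ((binghamZ2 ν i - binghamZ2 μ i) / binghamZ2 μ i) := by
    intro i
    have hz := z_pos μ i
    field_simp
    ring
  have Q : ∀ i, 1 / (2 * ε ^ 2) * (binghamZ2 μ i - binghamZ2 ν i) ^ 2 =
      1 / 2 * ((binghamZ2 μ i - binghamZ2 ν i) ^ 2 / ε ^ 2) := by
    intro i; field_simp
  unfold correction3d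
  rw [Z_eq, Z_eq, Real.log_div (NN_pos _).ne' (by positivity), Real.log_div (NN_pos _).ne' (by positivity)]
  simp only [Fin.sum_univ_three] at *
  rw [mul_add, mul_add, mul_add, mul_add, Q, Q, Q]
  have g0 := G 0; have g1 := G 1; have g2 := G 2
  rw [G'] at g0 g1 g2
  have l0 := L 0; have l1 := L 1; have l2 := L 2
  have es : s * (binghamZ2 ν 0 - binghamZ2 μ 0) + s * (binghamZ2 ν 1 - binghamZ2 μ 1) + s * (binghamZ2 ν 2 - binghamZ2 μ 2) = 0 := by
    linear_combination s * hws - s * hzs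
  linarith

lemma two_side (μ ν : Fin 3 → ℝ) {ε : ℝ} (hε : 0 < ε) (h1 : ∀ i, ε ≤ binghamZ2 μ i)
    (h2 : ∀ i, ε ≤ binghamZ2 ν i) :
    |correction3d μ - correction3d ν| ≤ 10 * (∑ i, |binghamZ2 μ i - binghamZ2 ν i|) +
      1 / (2 * ε ^ 2) * ∑ i, (binghamZ2 μ i - binghamZ2 ν i) ^ 2 := by
  have a := one_side μ ν hε h1 h2
  have b := one_side ν μ hε h2 h1
  have e1 : ∀ i, |binghamZ2 ν i - binghamZ2 μ i| = |binghamZ2 μ i - binghamZ2 ν i| :=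
    fun i => abs_sub_comm _ _
  have e2 : ∀ i, (binghamZ2 ν i - binghamZ2 μ i) ^ 2 = (binghamZ2 μ i - binghamZ2 ν i) ^ 2 :=
    fun i => by ring
  simp only [e1, e2] at b
  rw [abs_le]
  constructor <;> linarith

lemma F_eq (μ ν : Fin 3 → ℝ) (h : ∀ i, binghamZ2 μ i = binghamZ2 ν i) :
    correction3d μ = correction3d ν := by
  obtain ⟨k, hk⟩ := Finite.exists_min (binghamZ2 μ)
  have := two_side μ ν (z_pos μ k) hk (fun i => h i ▸ hk i)
  simp [h] at this
  linarith

lemma lip_n (μ ν : Fin 3 → ℝ) : ∃ M : ℝ, ∀ n : ℕ, 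
    |correction3d μ - correction3d ν| ≤ 10 * (∑ i, |binghamZ2 μ i - binghamZ2 ν i|) + M / (n + 1) := by
  obtain ⟨k1, hk1⟩ := Finite.exists_min (binghamZ2 μ)
  obtain ⟨k2, hk2⟩ := Finite.exists_min (binghamZ2 ν)
  set ε := min (binghamZ2 μ k1) (binghamZ2 ν k2) with hεd
  have hε : 0 < ε := lt_min (z_pos _ _) (z_pos _ _)
  have hμε : ∀ i, ε ≤ binghamZ2 μ i := fun i => (min_le_left _ _).trans (hk1 i)
  have hνε : ∀ i, ε ≤ binghamZ2 ν i := fun i => (min_le_right _ _).trans (hk2 i)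
  set d := ∑ i, |binghamZ2 μ i - binghamZ2 ν i| with hd
  set d2 := ∑ i, (binghamZ2 μ i - binghamZ2 ν i) ^ 2 with hd2
  refine ⟨1 / (2 * ε ^ 2) * d2, fun n => ?_⟩
  have hn : (0:ℝ) < n + 1 := by positivity
  have ex : ∀ t : ℝ, 0 ≤ t → t ≤ 1 → (∀ i, ε ≤ binghamZ2 μ i + t * (binghamZ2 ν i - binghamZ2 μ i)) := by
    intro t h0 h1 i
    have := hμε i; have := hνε i
    nlinarith
  have ex2 : ∀ t : ℝ, ∃ P : Fin 3 → ℝ, 0 ≤ t → t ≤ 1 → 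
      ∀ i, binghamZ2 P i = binghamZ2 μ i + t * (binghamZ2 ν i - binghamZ2 μ i) := by
    intro t
    by_cases h : 0 ≤ t ∧ t ≤ 1
    · obtain ⟨P, hP⟩ := surj (fun i => binghamZ2 μ i + t * (binghamZ2 ν i - binghamZ2 μ i)) (by
        rw [Finset.sum_add_distrib, ← Finset.mul_sum, Finset.sum_sub_distrib, z_sum, z_sum]; ring)
        (fun i => hε.trans_le (ex t h.1 h.2 i))
      exact ⟨P, fun _ _ => hP⟩
    · exact ⟨0, fun a b => absurd ⟨a, b⟩ h⟩
  choose P hP using ex2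
  set B := 10 * (d / (n + 1)) + 1 / (2 * ε ^ 2) * (d2 / (n + 1) ^ 2) with hB
  have step : ∀ l : ℕ, l ≤ n + 1 → |correction3d (P 0) - correction3d (P (l / (n + 1)))| ≤ l * B := by
    intro l
    induction l with
    | zero => simp
    | succ l ih =>
      intro hl
      have i1 := ih (by omega)
      have hl' : ((l:ℝ) + 1) ≤ n + 1 := by exact_mod_cast hl
      have t0 : 0 ≤ (l:ℝ) / (n + 1) := by positivity
      have t1 : (l:ℝ) / (n + 1) ≤ 1 := by rw [div_le_one hn]; linarith
      have s0 : 0 ≤ ((l + 1 : ℕ):ℝ) / (n + 1) := by positivity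
      have s1 : ((l + 1 : ℕ):ℝ) / (n + 1) ≤ 1 := by rw [div_le_one hn]; push_cast; linarith
      have z1 := hP _ t0 t1
      have z2 := hP _ s0 s1
      have ts := two_side (P (l / (n + 1))) (P ((l + 1 : ℕ) / (n + 1))) hε
        (fun i => by rw [z1]; exact ex _ t0 t1 i) (fun i => by rw [z2]; exact ex _ s0 s1 i)
      have df : ∀ i, binghamZ2 (P (l / (n + 1))) i - binghamZ2 (P ((l + 1 : ℕ) / (n + 1))) i
          = (binghamZ2 μ i - binghamZ2 ν i) / (n + 1) := by
        intro i; rw [z1, z2]; push_cast; field_simp; ring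
      simp only [df, abs_div, div_pow, ← Finset.sum_div, abs_of_pos hn] at ts
      have tri := abs_sub_le (correction3d (P 0)) (correction3d (P (l / (n + 1))))
        (correction3d (P ((l + 1 : ℕ) / (n + 1))))
      have : ((l + 1 : ℕ) : ℝ) * B = l * B + B := by push_cast; ring
      rw [this]
      linarith
  have fin := step (n + 1) le_rfl
  have e0 : correction3d (P 0) = correction3d μ := F_eq _ _ (fun i => by
    rw [hP 0 le_rfl zero_le_one]; ring)
  have e1 : correction3d (P (((n + 1 : ℕ):ℝ) / (n + 1))) = correction3d ν := F_eq _ _ (fun i => by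
    have : (((n + 1 : ℕ):ℝ) / (n + 1)) = 1 := by push_cast; field_simp
    rw [this, hP 1 zero_le_one le_rfl]; ring)
  rw [e0, e1] at fin
  refine fin.trans (le_of_eq ?_)
  rw [hB]; push_cast; field_simp

lemma lip (μ ν : Fin 3 → ℝ) :
    |correction3d μ - correction3d ν| ≤ 10 * (∑ i, |binghamZ2 μ i - binghamZ2 ν i|) := by
  obtain ⟨M, hM⟩ := lip_n μ ν
  have ht : Tendsto (fun n : ℕ => 10 * (∑ i, |binghamZ2 μ i - binghamZ2 ν i|) + M / ((n:ℝ) + 1))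
      atTop (nhds (10 * (∑ i, |binghamZ2 μ i - binghamZ2 ν i|) + 0)) := by
    refine tendsto_const_nhds.add ?_
    have := (tendsto_one_div_add_atTop_nhds_zero_nat (𝕜 := ℝ)).const_mul M
    simpa [div_eq_mul_inv] using this
  have := ge_of_tendsto' ht hM
  simpa using this

/-- Lipschitz continuity of the 3D correction term with respect to the moment
vector `z(μ)` in the Euclidean norm: there is a `C > 0` with
`|F(μ) − F(ν)| ≤ C ‖z(μ) − z(ν)‖`. -/
theorem correction_3d_lipschitz :
    ∃ C : ℝ, 0 < C ∧ ∀ μ ν : Fin 3 → ℝ,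
      |correction3d μ - correction3d ν| ≤
        C * Real.sqrt (∑ i, (binghamZ2 μ i - binghamZ2 ν i) ^ 2) := by
  refine ⟨30, by norm_num, fun μ ν => (lip μ ν).trans ?_⟩
  have h : ∀ i, |binghamZ2 μ i - binghamZ2 ν i| ≤
      Real.sqrt (∑ i, (binghamZ2 μ i - binghamZ2 ν i) ^ 2) := by
    intro i
    apply Real.abs_le_sqrt
    exact Finset.single_le_sum (f := fun i => (binghamZ2 μ i - binghamZ2 ν i) ^ 2)
      (fun i _ => sq_nonneg _) (Finset.mem_univ i)
  have h0 := h 0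
  have h1 := h 1
  have h2 := h 2
  rw [Fin.sum_univ_three (f := fun i => |binghamZ2 μ i - binghamZ2 ν i|)]
  linarith
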